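/- For every f ∈ L₂(G), every ω > 0 and every integer k ≥ 1, the best approximation of f by Paley-Wiener functions satisfies E(f,ω) = inf_{g ∈ PW_ω(L)} ‖f − g‖ ≤ ω^{−k/2}·⟨L^k f, f⟩^{1/2}; in particular, for even k = 2s this gives E(f,ω) ≤ ω^{−s}·‖L^s f‖. -/

import Mathlib

open scoped BigOperators

variable {V : Type*}

noncomputable def lapl (G : SimpleGraph V) [DecidableRel G.Adj] [G.LocallyFinite]
    (f : V → ℂ) (v : V) : ℂ :=
  ∑ u ∈ G.neighborFinset v, (f v - f u)

noncomputable def l2norm (f : V → ℂ) : ℝ :=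
  Real.sqrt (∑' v, ‖f v‖ ^ 2)

/-- `⟨L^k f, f⟩`, the Dirichlet form of the `k`-th power of the Laplacian. -/
noncomputable def dirichletPow (G : SimpleGraph V) [DecidableRel G.Adj] [G.LocallyFinite]
    (f : V → ℂ) (k : ℕ) : ℝ :=
  (∑' v, (lapl G)^[k] f v * (starRingEnd ℂ) (f v)).re

/-- The Paley–Wiener space `PW_ω(L)`: all `f ∈ L₂(G)` satisfying the Bernstein
inequality `‖L^k f‖ ≤ ω^k ‖f‖` for all `k ∈ ℕ`. -/
noncomputable def PW (G : SimpleGraph V) [DecidableRel G.Adj] [G.LocallyFinite] (ω : ℝ) :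
    Set (V → ℂ) :=
  {f | Memℓp f 2 ∧ ∀ k : ℕ, l2norm ((lapl G)^[k] f) ≤ ω ^ k * l2norm f}

/-- Best approximation `E(f,ω) = inf_{g ∈ PW_ω(L)} ‖f − g‖`. -/
noncomputable def bestApprox (G : SimpleGraph V) [DecidableRel G.Adj] [G.LocallyFinite]
    (f : V → ℂ) (ω : ℝ) : ℝ :=
  sInf ((fun g => l2norm (f - g)) '' PW G ω)

theorem norm_sq_cfc_apply {H : Type*} [NormedAddCommGroup H] [InnerProductSpace ℂ H]
    [CompleteSpace H] {A : H →L[ℂ] H} (hA : IsSelfAdjoint A)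
    {p : ℝ → ℝ} (hp : Continuous p) (x : H) :
    ‖cfc p A x‖ ^ 2 = (inner ℂ (cfc (fun t => p t ^ 2) A x) x).re := by
  have hsa : IsSelfAdjoint (cfc p A) := cfc_predicate p A
  rw [cfc_pow p 2 A (by fun_prop) hA, pow_two (cfc p A), mul_apply_eq_comp,
    ← ContinuousLinearMap.adjoint_inner_right, hsa.adjoint_eq, inner_self_eq_norm_sq_to_K]
  norm_cast

theorem inner_cfc_apply_mono {H : Type*} [NormedAddCommGroup H] [InnerProductSpace ℂ H]
    [CompleteSpace H] {A : H →L[ℂ] H} (hA : A.IsPositive) {p q : ℝ → ℝ} (hp : Continuous p)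
    (hq : Continuous q) (hpq : ∀ t, 0 ≤ t → p t ≤ q t) (x : H) :
    (inner ℂ (cfc p A x) x).re ≤ (inner ℂ (cfc q A x) x).re := by
  have hA' : 0 ≤ A := (ContinuousLinearMap.nonneg_iff_isPositive A).2 hA
  have h : cfc p A ≤ cfc q A :=
    cfc_mono (fun t ht => hpq t (spectrum_nonneg_of_nonneg hA' ht))
      (by fun_prop) (by fun_prop)
  have := ((ContinuousLinearMap.le_def _ _).1 h).re_inner_nonneg_left x
  simp only [sub_apply, inner_sub_left, map_sub] at this
  simpa using this

/-- A positive operator admits a Bernstein-bounded approximation `φ(A) f`, where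
`1 - φ(t) = min(1, (t / ω) ^ (k / 2))`. -/
theorem exists_bernstein_approx {H : Type*} [NormedAddCommGroup H] [InnerProductSpace ℂ H]
    [CompleteSpace H] {A : H →L[ℂ] H} (hA : A.IsPositive) {ω : ℝ} (hω : 0 < ω) (k : ℕ)
    (f : H) :
    ∃ g : H, (∀ m : ℕ, ‖(A ^ m) g‖ ≤ ω ^ m * ‖g‖) ∧
      ‖f - g‖ ^ 2 ≤ (ω ^ k)⁻¹ * (inner ℂ ((A ^ k) f) f).re := by
  have hsa : IsSelfAdjoint A := hA.isSelfAdjoint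
  set ψ : ℝ → ℝ := fun t => min 1 (√((ω ^ k)⁻¹ * t ^ k)) with hψ
  have hψc : Continuous ψ := by fun_prop
  set φ : ℝ → ℝ := fun t => 1 - ψ t with hφ
  have hφc : Continuous φ := by fun_prop
  refine ⟨cfc φ A f, fun m => ?_, ?_⟩
  · have hφ0 : ∀ t, ω ≤ t → φ t = 0 := by
      intro t ht
      have : 1 ≤ √((ω ^ k)⁻¹ * t ^ k) := by
        rw [Real.one_le_sqrt, ← div_eq_inv_mul, one_le_div (by positivity)]
        gcongr
      simp [hφ, hψ, this]
    have h1 : (A ^ m) (cfc φ A f) = cfc (fun t => t ^ m * φ t) A f := by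
      rw [cfc_mul (fun t => t ^ m) φ A (by fun_prop) (by fun_prop), cfc_pow_id A m]
      rfl
    refine le_of_sq_le_sq ?_ (by positivity)
    rw [h1, norm_sq_cfc_apply hsa (by fun_prop), mul_pow, norm_sq_cfc_apply hsa hφc]
    have h2 : (ω ^ m) ^ 2 * (inner ℂ (cfc (fun t => φ t ^ 2) A f) f).re =
        (inner ℂ (cfc (fun t => (ω ^ m) ^ 2 * φ t ^ 2) A f) f).re := by
      rw [cfc_const_mul ((ω ^ m) ^ 2) (fun t => φ t ^ 2) A (by fun_prop)]
      rw [smul_apply, RCLike.real_smul_eq_coe_smul (K := ℂ), inner_smul_left,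
        RCLike.conj_ofReal]
      exact (Complex.re_ofReal_mul _ _).symm
    rw [h2]
    refine inner_cfc_apply_mono hA (by fun_prop) (by fun_prop) (fun t ht => ?_) f
    rcases le_total ω t with h | h
    · simp [hφ0 t h]
    · rw [mul_pow]; gcongr
  · have h1 : f - cfc φ A f = cfc ψ A f := by
      rw [hφ, cfc_sub (fun _ => 1) ψ A (by fun_prop) (by fun_prop), cfc_const_one ℝ A]
      simp
    rw [h1, norm_sq_cfc_apply hsa hψc]
    have h2 : (ω ^ k)⁻¹ * (inner ℂ ((A ^ k) f) f).re =
        (inner ℂ (cfc (fun t => (ω ^ k)⁻¹ * t ^ k) A f) f).re := by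
      rw [cfc_const_mul ((ω ^ k)⁻¹) (fun t => t ^ k) A (by fun_prop), cfc_pow_id A k]
      rw [smul_apply, RCLike.real_smul_eq_coe_smul (K := ℂ), inner_smul_left,
        RCLike.conj_ofReal]
      exact (Complex.re_ofReal_mul _ _).symm
    rw [h2]
    refine inner_cfc_apply_mono hA (by fun_prop) (by fun_prop) (fun t ht => ?_) f
    have h0 : 0 ≤ (ω ^ k)⁻¹ * t ^ k := by positivity
    calc ψ t ^ 2 ≤ (√((ω ^ k)⁻¹ * t ^ k)) ^ 2 := by
          have : 0 ≤ ψ t := le_min zero_le_one (Real.sqrt_nonneg _)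
          gcongr
          exact min_le_right _ _
      _ = _ := Real.sq_sqrt h0

/-- The space `L₂(G)` of square-summable complex functions on a set of vertices. -/
noncomputable abbrev EllTwo (X : Type*) := lp (fun _ : X => ℂ) 2

theorem memℓp_two_iff_summable_sq {X : Type*} {f : X → ℂ} :
    Memℓp f 2 ↔ Summable fun x => ‖f x‖ ^ 2 := by
  rw [memℓp_gen_iff (by simp)]
  simp

theorem l2norm_eq_norm {X : Type*} (f : EllTwo X) : l2norm (f : X → ℂ) = ‖f‖ := by
  rw [l2norm, lp.norm_eq_tsum_rpow (by simp), Real.sqrt_eq_rpow]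
  simp

theorem summable_adj_fst (G : SimpleGraph V) [DecidableRel G.Adj] [G.LocallyFinite] {D : ℕ}
    (hD : ∀ v, G.degree v ≤ D) {h : V → ℝ} (h0 : ∀ v, 0 ≤ h v) (hh : Summable h) :
    Summable fun e : V × V => if G.Adj e.1 e.2 then h e.1 else 0 := by
  have key : ∀ v, HasSum (fun u => if G.Adj v u then h v else 0) (G.degree v * h v) := by
    intro v
    have := hasSum_sum_of_ne_finset_zero (L := .unconditional V) (s := G.neighborFinset v)
      (f := fun u => if G.Adj v u then h v else 0) (by simp +contextual)
    convert this using 1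
    rw [Finset.sum_congr rfl (g := fun _ => h v) (by simp +contextual)]
    simp
  refine (summable_prod_of_nonneg fun e => ?_).2 ⟨fun v => (key v).summable, ?_⟩
  · dsimp only
    split_ifs
    exacts [h0 _, le_rfl]
  · simp_rw [(key _).tsum_eq]
    refine Summable.of_nonneg_of_le (fun v => mul_nonneg (by positivity) (h0 v)) (fun v => ?_)
      (hh.mul_left (D : ℝ))
    have := h0 v
    gcongr
    exact hD v

theorem memℓp_grad (G : SimpleGraph V) [DecidableRel G.Adj] [G.LocallyFinite] {D : ℕ}
    (hD : ∀ v, G.degree v ≤ D) {f : V → ℂ} (hf : Memℓp f 2) :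
    Memℓp (fun e : V × V => if G.Adj e.1 e.2 then f e.1 - f e.2 else 0) 2 := by
  have h1 : Memℓp (fun e : V × V => if G.Adj e.1 e.2 then f e.1 else 0) 2 := by
    rw [memℓp_two_iff_summable_sq] at hf ⊢
    convert summable_adj_fst G hD (fun v => by positivity) hf using 2 with e
    split_ifs <;> simp
  have h2 : Memℓp (fun e : V × V => if G.Adj e.1 e.2 then f e.2 else 0) 2 := by
    rw [memℓp_two_iff_summable_sq] at h1 ⊢
    convert (Equiv.prodComm V V).summable_iff.2 h1 using 2 with e
    simp [G.adj_comm]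
  convert h1.sub h2 using 1
  ext e
  simp only [Pi.sub_apply]
  split_ifs <;> simp

/-- The gradient of a function, as a function on ordered pairs of adjacent vertices. -/
noncomputable def gradLM (G : SimpleGraph V) [DecidableRel G.Adj] [G.LocallyFinite] {D : ℕ}
    (hD : ∀ v, G.degree v ≤ D) : EllTwo V →ₗ[ℂ] EllTwo (V × V) where
  toFun f := ⟨fun e => if G.Adj e.1 e.2 then f e.1 - f e.2 else 0, memℓp_grad G hD f.2⟩
  map_add' f g := by
    ext e
    change (if G.Adj e.1 e.2 then (f e.1 + g e.1) - (f e.2 + g e.2) else 0 : ℂ) =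
      (if G.Adj e.1 e.2 then f e.1 - f e.2 else 0) + (if G.Adj e.1 e.2 then g e.1 - g e.2 else 0)
    split_ifs <;> ring
  map_smul' c f := by
    ext e
    change (if G.Adj e.1 e.2 then c * f e.1 - c * f e.2 else 0 : ℂ) =
      c * (if G.Adj e.1 e.2 then f e.1 - f e.2 else 0)
    split_ifs <;> ring

theorem gradLM_apply (G : SimpleGraph V) [DecidableRel G.Adj] [G.LocallyFinite] {D : ℕ}
    (hD : ∀ v, G.degree v ≤ D) (f : EllTwo V) (e : V × V) :
    gradLM G hD f e = if G.Adj e.1 e.2 then f e.1 - f e.2 else 0 := rfl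

/-- The gradient as a bounded operator. -/
noncomputable def grad (G : SimpleGraph V) [DecidableRel G.Adj] [G.LocallyFinite] {D : ℕ}
    (hD : ∀ v, G.degree v ≤ D) : EllTwo V →L[ℂ] EllTwo (V × V) :=
  ContinuousLinearMap.ofSeqClosedGraph (g := gradLM G hD) <| by
    intro u x y hu hy
    ext e
    have eval : ∀ {X : Type _} (w : ℕ → EllTwo X) (z : EllTwo X) (i : X),
        Filter.Tendsto w Filter.atTop (nhds z) →
          Filter.Tendsto (fun n => (w n i : ℂ)) Filter.atTop (nhds (z i : ℂ)) := fun {X} w z i h =>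
      ((lp.evalCLM ℂ (fun _ : X => ℂ) 2 i).continuous.tendsto z).comp h
    refine tendsto_nhds_unique (eval _ _ e hy) ?_
    simp only [Function.comp_apply, gradLM_apply]
    split_ifs
    · exact Filter.Tendsto.sub (G := ℂ) (eval _ _ e.1 hu) (eval _ _ e.2 hu)
    · exact tendsto_const_nhds

theorem grad_apply (G : SimpleGraph V) [DecidableRel G.Adj] [G.LocallyFinite] {D : ℕ}
    (hD : ∀ v, G.degree v ≤ D) (f : EllTwo V) (e : V × V) :
    grad G hD f e = if G.Adj e.1 e.2 then f e.1 - f e.2 else 0 := rfl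

open Classical in
theorem hasSum_lapl (G : SimpleGraph V) [DecidableRel G.Adj] [G.LocallyFinite] (f : V → ℂ)
    (v : V) :
    HasSum (fun e : V × V => if G.Adj e.1 e.2 ∧ e.1 = v then f e.1 - f e.2 else 0)
      (lapl G f v) := by
  have hinj : Function.Injective (Prod.mk v : V → V × V) := Prod.mk_right_injective v
  rw [← hinj.hasSum_iff]
  · have := hasSum_sum_of_ne_finset_zero (L := .unconditional V) (s := G.neighborFinset v)
      (f := fun u => if G.Adj v u then f v - f u else 0) (by simp +contextual)
    convert this using 1
    · ext u; simp
    · exact Finset.sum_congr rfl (by simp +contextual)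
  · rintro ⟨a, b⟩ hab
    refine if_neg ?_
    rintro ⟨-, rfl⟩
    exact hab ⟨b, rfl⟩

/-- The Laplacian as a bounded operator, in divergence form. -/
noncomputable def laplCLM (G : SimpleGraph V) [DecidableRel G.Adj] [G.LocallyFinite] {D : ℕ}
    (hD : ∀ v, G.degree v ≤ D) : EllTwo V →L[ℂ] EllTwo V :=
  (2⁻¹ : ℂ) • ((grad G hD).adjoint ∘SL grad G hD)

theorem laplCLM_isPositive (G : SimpleGraph V) [DecidableRel G.Adj] [G.LocallyFinite] {D : ℕ}
    (hD : ∀ v, G.degree v ≤ D) : (laplCLM G hD).IsPositive :=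
  (ContinuousLinearMap.isPositive_adjoint_comp_self _).smul_of_nonneg
    (RCLike.nonneg_iff.2 (by norm_num))

theorem coe_laplCLM (G : SimpleGraph V) [DecidableRel G.Adj] [G.LocallyFinite] {D : ℕ}
    (hD : ∀ v, G.degree v ≤ D) (f : EllTwo V) :
    (laplCLM G hD f : V → ℂ) = lapl G f := by
  classical
  ext v
  have h1 : inner ℂ (lp.single 2 v (1 : ℂ)) (laplCLM G hD f) = laplCLM G hD f v := by
    rw [lp.inner_single_left]
    simp
  have h2 : HasSum (fun e : V × V => inner ℂ (grad G hD (lp.single 2 v (1 : ℂ)) e)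
      (grad G hD f e)) (lapl G f v + lapl G f v) := by
    convert (hasSum_lapl G f v).add ((Equiv.prodComm V V).hasSum_iff.2 (hasSum_lapl G f v))
      using 2 with e
    obtain ⟨a, b⟩ := e
    simp only [grad_apply, lp.single_apply, Pi.single_apply, Function.comp_apply,
      Equiv.prodComm_apply, Prod.swap_prod_mk, G.adj_comm b a]
    by_cases hab : G.Adj a b
    · by_cases ha : a = v <;> by_cases hb : b = v <;> simp only [hab, ha, hb] <;> simp_all
    · simp [hab]
  rw [← h1, laplCLM, smul_apply, inner_smul_right,
    ContinuousLinearMap.comp_apply, ContinuousLinearMap.adjoint_inner_right,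
    lp.inner_eq_tsum, h2.tsum_eq]
  ring

theorem coe_laplCLM_pow (G : SimpleGraph V) [DecidableRel G.Adj] [G.LocallyFinite] {D : ℕ}
    (hD : ∀ v, G.degree v ≤ D) (f : EllTwo V) (m : ℕ) :
    (((laplCLM G hD) ^ m) f : V → ℂ) = (lapl G)^[m] f := by
  induction m with
  | zero => simp
  | succ m ih =>
    rw [pow_succ', mul_apply_eq_comp, coe_laplCLM, ih, Function.iterate_succ_apply']

theorem dirichletPow_eq_re_inner (G : SimpleGraph V) [DecidableRel G.Adj] [G.LocallyFinite]
    {D : ℕ} (hD : ∀ v, G.degree v ≤ D) (f : EllTwo V) (k : ℕ) :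
    dirichletPow G f k = (inner ℂ (((laplCLM G hD) ^ k) f) f).re := by
  rw [dirichletPow, ← coe_laplCLM_pow G hD, ← inner_conj_symm, Complex.conj_re,
    lp.inner_eq_tsum]
  simp

theorem dirichletPow_two_mul (G : SimpleGraph V) [DecidableRel G.Adj] [G.LocallyFinite]
    {D : ℕ} (hD : ∀ v, G.degree v ≤ D) (f : EllTwo V) (s : ℕ) :
    dirichletPow G f (2 * s) = l2norm ((lapl G)^[s] f) ^ 2 := by
  have hsa : IsSelfAdjoint (laplCLM G hD ^ s) := (laplCLM_isPositive G hD).isSelfAdjoint.pow s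
  rw [dirichletPow_eq_re_inner G hD, ← coe_laplCLM_pow G hD, l2norm_eq_norm, two_mul, pow_add,
    mul_apply_eq_comp, ← ContinuousLinearMap.adjoint_inner_right, hsa.adjoint_eq,
    inner_self_eq_norm_sq_to_K]
  norm_cast

theorem stmt13 [Countable V] (G : SimpleGraph V) [DecidableRel G.Adj] [G.LocallyFinite]
    (hconn : G.Connected) (D : ℕ) (hD : ∀ v, G.degree v ≤ D)
    (f : V → ℂ) (hf : Memℓp f 2) (ω : ℝ) (hω : 0 < ω) :
    (∀ k : ℕ, 1 ≤ k →
      bestApprox G f ω ≤ ω ^ (-(k : ℝ) / 2) * Real.sqrt (dirichletPow G f k)) ∧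
    (∀ s : ℕ, 1 ≤ s →
      bestApprox G f ω ≤ (ω ^ s)⁻¹ * l2norm ((lapl G)^[s] f)) := by
  set F : EllTwo V := ⟨f, hf⟩
  have hF : (F : V → ℂ) = f := rfl
  have main : ∀ k : ℕ,
      bestApprox G f ω ≤ √((ω ^ k)⁻¹ * dirichletPow G f k) := by
    intro k
    obtain ⟨g, hg, hfg⟩ := exists_bernstein_approx (laplCLM_isPositive G hD) hω k F
    have hle : bestApprox G f ω ≤ ‖F - g‖ := by
      refine csInf_le ⟨0, ?_⟩ ⟨g, ⟨g.2, fun m => ?_⟩, ?_⟩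
      · rintro _ ⟨h, -, rfl⟩
        exact Real.sqrt_nonneg _
      · rw [← coe_laplCLM_pow G hD, l2norm_eq_norm, l2norm_eq_norm]
        exact hg m
      · rw [← l2norm_eq_norm]
        rfl
    refine hle.trans (Real.le_sqrt_of_sq_le ?_)
    rwa [← hF, dirichletPow_eq_re_inner G hD]
  refine ⟨fun k _ => (main k).trans_eq ?_, fun s _ => (main (2 * s)).trans_eq ?_⟩
  · rw [Real.sqrt_mul (by positivity), ← Real.rpow_natCast, ← Real.rpow_neg hω.le,
      Real.sqrt_eq_rpow, ← Real.rpow_mul hω.le]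
    congr 2
    ring
  · rw [← hF, dirichletPow_two_mul G hD, mul_comm 2 s, pow_mul, ← inv_pow, ← mul_pow]
    exact Real.sqrt_sq (mul_nonneg (by positivity) (Real.sqrt_nonneg _))
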